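/- arXiv:2311.00749 — 7 statements merged into one kernel-verified Lean document; each statement's English description precedes it below -/
import Mathlib

section
/- Let n and U′ be positive integers with 2^{U′} ≤ n, and set b = 2^{U′}. The number of permutations σ of {0,1,…,n−1} satisfying Σ_{i=0}^{n−1} log₂(|σ(i) − i| + 2) ≤ n·(U′ + 1) is at least (b!)^{⌊n/b⌋}. -/
/-- Embedding of `q` blocks of length `b` into `Fin n`. -/
def blockEmb (n b q : ℕ) (h : q * b ≤ n) : (Σ _ : Fin q, Fin b) ↪ Fin n where
  toFun x := ⟨x.1.1 * b + x.2.1, by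
    have h1 := x.1.2
    have h2 := x.2.2
    have h3 : (x.1.1 + 1) * b ≤ q * b := Nat.mul_le_mul_right _ h1
    rw [Nat.add_mul] at h3
    omega⟩
  inj' := by
    rintro ⟨k, j⟩ ⟨k', j'⟩ hx
    have hx' : k.1 * b + j.1 = k'.1 * b + j'.1 := congrArg Fin.val hx
    have hb : 0 < b := lt_of_le_of_lt (Nat.zero_le _) j.2
    have hk : k.1 = k'.1 := by
      have := congrArg (· / b) hx'
      simpa [Nat.mul_comm _ b, Nat.mul_add_div hb, Nat.div_eq_of_lt j.2,
        Nat.div_eq_of_lt j'.2] using this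
    have hj : j.1 = j'.1 := by rw [hk] at hx'; omega
    have hk' : k = k' := Fin.ext hk
    have hj' : j = j' := Fin.ext hj
    subst hk'
    subst hj'
    rfl

/-- With `b = 2^U'` and `2^U' ≤ n`, the number of permutations `σ` of `{0,…,n−1}`
with `Σ_i log₂(|σ(i) − i| + 2) ≤ n·(U' + 1)` is at least `(b!)^⌊n/b⌋`. -/
theorem candidate_set_lower_bound (n U' : ℕ) (hn : 0 < n) (hU' : 0 < U')
    (hle : 2 ^ U' ≤ n) :
    (Nat.factorial (2 ^ U')) ^ (n / 2 ^ U') ≤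
      Nat.card {σ : Equiv.Perm (Fin n) //
        ∑ i : Fin n, Real.logb 2 ((|(σ i : ℤ) - (i : ℤ)| : ℝ) + 2) ≤
          (n : ℝ) * ((U' : ℝ) + 1)} := by
  classical
  let e := blockEmb n (2 ^ U') (n / 2 ^ U') (Nat.div_mul_le_self _ _)
  let F : (Fin (n / 2 ^ U') → Equiv.Perm (Fin (2 ^ U'))) → Equiv.Perm (Fin n) := fun f =>
    (Equiv.Perm.sigmaCongrRight f).viaEmbedding e
  have hF : Function.Injective F := by
    intro f g hfg
    have h1 := Equiv.Perm.viaEmbeddingHom_injective e hfg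
    exact Equiv.Perm.sigmaCongrRightHom_injective h1
  have hb1 : 1 ≤ 2 ^ U' := Nat.one_le_two_pow
  have hd : ∀ f i, |((F f i : ℕ) : ℤ) - ((i : ℕ) : ℤ)| + 1 ≤ 2 ^ U' := by
    intro f i
    by_cases hi : i ∈ Set.range e
    · obtain ⟨⟨k, j⟩, rfl⟩ := hi
      have h1 : F f (e ⟨k, j⟩) = e ⟨k, f k j⟩ := Equiv.Perm.viaEmbedding_apply _ _ _
      rw [h1]
      have h2 : (e ⟨k, j⟩ : ℕ) = k.1 * 2 ^ U' + j.1 := rfl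
      have h3 : (e ⟨k, f k j⟩ : ℕ) = k.1 * 2 ^ U' + (f k j).1 := rfl
      rw [h2, h3]
      have h4 := j.2
      have h5 := (f k j).2
      zify at h4 h5
      push_cast
      have h6 : |(k.1 : ℤ) * 2 ^ U' + ((f k j).1 : ℤ) - ((k.1 : ℤ) * 2 ^ U' + (j.1 : ℤ))|
          ≤ 2 ^ U' - 1 := by
        rw [abs_le]
        constructor <;> linarith [Int.natCast_nonneg j.1, Int.natCast_nonneg (f k j).1]
      linarith
    · have h1 : F f i = i := Equiv.Perm.viaEmbedding_apply_of_notMem _ _ _ hi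
      rw [h1]
      simp
      exact_mod_cast hb1
  have hmem : ∀ f, ∑ i : Fin n, Real.logb 2 ((|(F f i : ℤ) - (i : ℤ)| : ℝ) + 2) ≤
          (n : ℝ) * ((U' : ℝ) + 1) := by
    intro f
    have : ∀ i ∈ (Finset.univ : Finset (Fin n)),
        Real.logb 2 ((|(F f i : ℤ) - (i : ℤ)| : ℝ) + 2) ≤ (U' : ℝ) + 1 := by
      intro i _
      have h1 : ((|(F f i : ℤ) - (i : ℤ)| : ℝ)) + 1 ≤ 2 ^ U' := by exact_mod_cast hd f i
      have h0 : (0 : ℝ) ≤ (|(F f i : ℤ) - (i : ℤ)| : ℝ) := abs_nonneg _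
      have h2 : (1 : ℝ) ≤ 2 ^ U' := by exact_mod_cast hb1
      rw [Real.logb_le_iff_le_rpow (by norm_num) (by linarith)]
      have h3 : (2 : ℝ) ^ ((U' : ℝ) + 1) = 2 ^ U' * 2 := by
        rw [Real.rpow_add (by norm_num), Real.rpow_natCast, Real.rpow_one]
      rw [h3]
      linarith
    have := Finset.sum_le_card_nsmul _ _ _ this
    simpa [mul_add] using this
  have hc := Nat.card_le_card_of_injective
    (fun f => (⟨F f, hmem f⟩ : {σ : Equiv.Perm (Fin n) //
        ∑ i : Fin n, Real.logb 2 ((|(σ i : ℤ) - (i : ℤ)| : ℝ) + 2) ≤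
          (n : ℝ) * ((U' : ℝ) + 1)}))
    (fun f g h => hF (congrArg Subtype.val h))
  refine le_trans (le_of_eq ?_) hc
  simp [Fintype.card_perm]
end

section
/- Let n, U′ be positive integers with 2 ≤ U′ and b = 2^{U′} dividing n, and let S be the set of permutations σ of {0,1,…,n−1} with Σ_{i=0}^{n−1} log₂(|σ(i) − i| + 2) ≤ n·(U′ + 1). If there exists an injective function from S into the set of binary strings of length x (functions from {0,…,x−1} to {false,true}), then x ≥ (n/b)·log₂(b!) ≥ (n/2)·(U′ − 1). -/
/-- Information-theoretic lower bound: with `b = 2^U'` dividing `n` and `U' ≥ 2`, if the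
set `S` of permutations `σ` of `{0,…,n−1}` with `Σ_i log₂(|σ(i) − i| + 2) ≤ n·(U'+1)`
injects into binary strings of length `x`, then
`x ≥ (n/b)·log₂(b!) ≥ (n/2)·(U' − 1)`. -/
theorem sorting_lower_bound (n U' x : ℕ) (hn : 0 < n) (hU' : 2 ≤ U')
    (hdvd : 2 ^ U' ∣ n)
    (f : {σ : Equiv.Perm (Fin n) //
        ∑ i : Fin n, Real.logb 2 ((|(σ i : ℤ) - (i : ℤ)| : ℝ) + 2) ≤
          (n : ℝ) * ((U' : ℝ) + 1)} → (Fin x → Bool))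
    (hf : Function.Injective f) :
    ((n : ℝ) / (2 ^ U' : ℝ)) * Real.logb 2 (Nat.factorial (2 ^ U') : ℝ) ≤ (x : ℝ) ∧
    ((n : ℝ) / 2) * ((U' : ℝ) - 1) ≤
      ((n : ℝ) / (2 ^ U' : ℝ)) * Real.logb 2 (Nat.factorial (2 ^ U') : ℝ) := by
  obtain ⟨m, hm⟩ := hdvd
  rw [mul_comm] at hm
  subst hm
  have hb : (0 : ℝ) < 2 ^ U' := by positivity
  have hdiv : (((m * 2 ^ U' : ℕ) : ℝ) / (2 ^ U' : ℝ)) = m := by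
    push_cast
    field_simp
  rw [hdiv]
  constructor
  · have hmem : ∀ g : Fin m → Equiv.Perm (Fin (2 ^ U')),
        ∑ i : Fin (m * 2 ^ U'), Real.logb 2
          ((|((finProdFinEquiv.permCongr (Equiv.prodCongrRight g) i : ℕ) : ℤ) - ((i : ℕ) : ℤ)| : ℝ) + 2)
          ≤ ((m * 2 ^ U' : ℕ) : ℝ) * ((U' : ℝ) + 1) := by
      intro g
      have h1 : ∀ i ∈ (Finset.univ : Finset (Fin (m * 2 ^ U'))), Real.logb 2
          ((|((finProdFinEquiv.permCongr (Equiv.prodCongrRight g) i : ℕ) : ℤ) - ((i : ℕ) : ℤ)| : ℝ) + 2)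
          ≤ (U' : ℝ) + 1 := by
        intro i _
        obtain ⟨⟨p, q⟩, rfl⟩ := finProdFinEquiv.surjective i
        have hq : (q : ℕ) < 2 ^ U' := q.2
        have hr : (g p q : ℕ) < 2 ^ U' := (g p q).2
        rw [Real.logb_le_iff_le_rpow (by norm_num) (by positivity)]
        have e : (2 : ℝ) ^ ((U' : ℝ) + 1) = 2 ^ U' * 2 := by
          rw [Real.rpow_add (by norm_num), Real.rpow_natCast, Real.rpow_one]
        rw [e]
        have h4 : (2 : ℝ) ^ 2 ≤ 2 ^ U' := pow_le_pow_right₀ (by norm_num) hU'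
        have hq' : (q : ℝ) < 2 ^ U' := by exact_mod_cast hq
        have hr' : ((g p q : ℕ) : ℝ) < 2 ^ U' := by exact_mod_cast hr
        have hq0 : (0 : ℝ) ≤ ((q : ℕ) : ℝ) := by positivity
        have hr0 : (0 : ℝ) ≤ ((g p q : ℕ) : ℝ) := by positivity
        simp only [Equiv.permCongr_apply, Equiv.symm_apply_apply, Equiv.prodCongrRight_apply,
          finProdFinEquiv_apply_val, Int.cast_natCast]
        push_cast
        rw [add_sub_add_right_eq_sub]
        have : |((g p q : ℕ) : ℝ) - ((q : ℕ) : ℝ)| ≤ 2 ^ U' := by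
          rw [abs_le]; constructor <;> linarith
        linarith
      have h2 := Finset.sum_le_sum h1
      rw [Finset.sum_const, Finset.card_univ, Fintype.card_fin, nsmul_eq_mul] at h2
      exact h2
    have hinj : Function.Injective
        (fun g : Fin m → Equiv.Perm (Fin (2 ^ U')) => f ⟨_, hmem g⟩) := by
      intro g g' h
      have h1 := congrArg Subtype.val (hf h)
      have h2 := finProdFinEquiv.permCongr.injective h1
      funext p
      ext q
      have h3 := congrArg (fun e => (e (p, q)).2) h2
      simpa using congrArg Fin.val h3
    have hc := Fintype.card_le_of_injective _ hinj
    simp only [Fintype.card_fun, Fintype.card_perm, Fintype.card_fin, Fintype.card_bool] at hc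
    have hfac : (0 : ℝ) < (Nat.factorial (2 ^ U') : ℝ) := by
      exact_mod_cast Nat.factorial_pos _
    rw [← Real.logb_pow, Real.logb_le_iff_le_rpow (by norm_num) (by positivity),
      Real.rpow_natCast]
    exact_mod_cast hc
  · obtain ⟨k, rfl⟩ : ∃ k, U' = k + 1 := ⟨U' - 1, by omega⟩
    have h1 : (2 ^ k) ^ (2 ^ k) ≤ Nat.factorial (2 ^ (k + 1)) := by
      have h := Nat.factorial_mul_pow_le_factorial (m := 2 ^ k) (n := 2 ^ k)
      have e : 2 ^ (k + 1) = 2 ^ k + 2 ^ k := by ring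
      rw [e]
      refine le_trans ?_ h
      calc (2 ^ k) ^ (2 ^ k) ≤ (2 ^ k + 1) ^ (2 ^ k) := Nat.pow_le_pow_left (by omega) _
        _ ≤ _ := Nat.le_mul_of_pos_left _ (Nat.factorial_pos _)
    have h2 : (2 : ℝ) ^ k * k ≤ Real.logb 2 (Nat.factorial (2 ^ (k + 1)) : ℝ) := by
      have hfac : (0 : ℝ) < (Nat.factorial (2 ^ (k + 1)) : ℝ) := by
        exact_mod_cast Nat.factorial_pos _
      rw [Real.le_logb_iff_rpow_le (by norm_num) hfac]
      have e : (2 : ℝ) ^ ((2 : ℝ) ^ k * k) = (((2 ^ k) ^ (2 ^ k) : ℕ) : ℝ) := by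
        have : (2 : ℝ) ^ k * k = ((k * 2 ^ k : ℕ) : ℝ) := by push_cast; ring
        rw [this, Real.rpow_natCast, pow_mul]
        push_cast
        rfl
      rw [e]
      exact_mod_cast h1
    have h3 := mul_le_mul_of_nonneg_left h2 (Nat.cast_nonneg (α := ℝ) m)
    refine le_trans (le_of_eq ?_) h3
    push_cast
    ring
end

section
/- Let n ≥ 2, let p be a permutation of {1,…,n}, let p̂ : {1,…,n} → {1,…,n} be nondecreasing, and set η_j = |p(j) − p̂(j)| for each j. Then for every i with 2 ≤ i ≤ n: |p(i) − p(i−1)| + 1 ≤ 3·max{η_i + 1, η_{i−1} + 1, p̂(i) − p̂(i−1) + 1}. -/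
/-- For a permutation `p` of `{1,…,n}`, a nondecreasing prediction `p̂ : {1,…,n} → {1,…,n}`,
and errors `η_j = |p(j) − p̂(j)|`, for every `2 ≤ i ≤ n`:
`|p(i) − p(i−1)| + 1 ≤ 3·max{η_i + 1, η_{i−1} + 1, p̂(i) − p̂(i−1) + 1}`. -/
theorem displacement_gap_bound (n : ℕ) (hn : 2 ≤ n) (p phat : ℕ → ℕ)
    (hp : Set.BijOn p (Set.Icc 1 n) (Set.Icc 1 n))
    (hphatmem : ∀ i ∈ Finset.Icc 1 n, phat i ∈ Finset.Icc 1 n)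
    (hmono : ∀ i j, 1 ≤ i → i ≤ j → j ≤ n → phat i ≤ phat j) :
    ∀ i, 2 ≤ i → i ≤ n →
      |(p i : ℤ) - (p (i - 1) : ℤ)| + 1 ≤
        3 * max (|(p i : ℤ) - (phat i : ℤ)| + 1)
            (max (|(p (i - 1) : ℤ) - (phat (i - 1) : ℤ)| + 1)
              ((phat i : ℤ) - (phat (i - 1) : ℤ) + 1)) := by
  intro i h2 hin
  have hm : phat (i - 1) ≤ phat i := hmono (i - 1) i (by omega) (by omega) hin
  generalize i - 1 = k at *
  have hm' : (phat k : ℤ) ≤ phat i := by exact_mod_cast hm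
  generalize (p i : ℤ) = a at *
  generalize (p k : ℤ) = b at *
  generalize (phat i : ℤ) = c at *
  generalize (phat k : ℤ) = d at *
  have e1 := le_max_left (|a - c| + 1) (max (|b - d| + 1) (c - d + 1))
  have e2 := le_max_right (|a - c| + 1) (max (|b - d| + 1) (c - d + 1))
  have e3 := le_max_left (|b - d| + 1) (c - d + 1)
  have e4 := le_max_right (|b - d| + 1) (c - d + 1)
  have a1 := le_abs_self (a - c)
  have a2 := neg_abs_le (a - c)
  have b1 := le_abs_self (b - d)
  have b2 := neg_abs_le (b - d)
  rcases abs_cases (a - b) with ⟨h, _⟩ | ⟨h, _⟩ <;> rw [h] <;> linarith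
end

section
/- Let n ≥ 2, let p be a permutation of {1,…,n}, let p̂ : {1,…,n} → {1,…,n} be nondecreasing, and set η_j = |p(j) − p̂(j)| for each j. Then Σ_{i=2}^{n} log₂(|p(i) − p(i−1)| + 1) ≤ (n−1)·log₂ 3 + n + 2·Σ_{i=1}^{n} log₂(η_i + 1). -/
lemma step_log (x y : ℝ) (a b : ℕ) (hab : a ≤ b) :
    Real.logb 2 (|y - x| + 1) ≤
      Real.logb 2 (|x - a| + 1) + Real.logb 2 (|y - b| + 1) + ((b : ℝ) - a) := by
  obtain ⟨d, rfl⟩ := Nat.exists_eq_add_of_le hab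
  have h1 : (1 : ℝ) + d ≤ 2 ^ d := by
    have := Nat.lt_two_pow_self (n := d)
    have h : 1 + d ≤ 2 ^ d := by omega
    exact_mod_cast h
  have hx := abs_nonneg (x - a)
  have hy := abs_nonneg (y - ((a + d : ℕ) : ℝ))
  have hd : (0 : ℝ) ≤ d := Nat.cast_nonneg d
  have htri : |y - x| ≤ |x - a| + |y - ((a + d : ℕ) : ℝ)| + d := by
    have e1 := le_abs_self (x - a)
    have e2 := neg_abs_le (x - a)
    have e3 := le_abs_self (y - ((a + d : ℕ) : ℝ))
    have e4 := neg_abs_le (y - ((a + d : ℕ) : ℝ))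
    push_cast at e3 e4 ⊢
    rw [abs_le]
    constructor <;> linarith
  have hpow : Real.logb 2 ((2 : ℝ) ^ d) = d := by
    rw [Real.logb_pow, Real.logb_self_eq_one (by norm_num)]; ring
  have e : (((a + d : ℕ) : ℝ) - a) = d := by push_cast; ring
  rw [e]
  generalize |y - ((a + d : ℕ) : ℝ)| = v at *
  generalize |x - (a : ℝ)| = u at *
  rw [← hpow, ← Real.logb_mul (by positivity) (by positivity),
    ← Real.logb_mul (by positivity) (by positivity)]
  apply Real.logb_le_logb_of_le (by norm_num) (by positivity)
  have h2 : (u + 1) * (v + 1) * (1 + d) ≤ (u + 1) * (v + 1) * 2 ^ d := by gcongr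
  have h3 := mul_nonneg hx hy
  have h4 := mul_nonneg hx hd
  have h5 := mul_nonneg hy hd
  have h6 := mul_nonneg h3 hd
  nlinarith

/-- For a permutation `p` of `{1,…,n}`, a nondecreasing prediction `p̂ : {1,…,n} → {1,…,n}`,
and errors `η_j = |p(j) − p̂(j)|`:
`Σ_{i=2}^n log₂(|p(i) − p(i−1)| + 1) ≤ (n−1)·log₂3 + n + 2·Σ_{i=1}^n log₂(η_i + 1)`. -/
theorem displacement_sort_sum_bound (n : ℕ) (hn : 2 ≤ n) (p phat : ℕ → ℕ)
    (hp : Set.BijOn p (Set.Icc 1 n) (Set.Icc 1 n))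
    (hphatmem : ∀ i ∈ Finset.Icc 1 n, phat i ∈ Finset.Icc 1 n)
    (hmono : ∀ i j, 1 ≤ i → i ≤ j → j ≤ n → phat i ≤ phat j) :
    ∑ i ∈ Finset.Icc 2 n, Real.logb 2 ((|(p i : ℤ) - (p (i - 1) : ℤ)| : ℝ) + 1) ≤
      ((n : ℝ) - 1) * Real.logb 2 3 + (n : ℝ) +
        2 * ∑ i ∈ Finset.Icc 1 n, Real.logb 2 ((|(p i : ℤ) - (phat i : ℤ)| : ℝ) + 1) := by
  have key : ∀ m : ℕ, 1 ≤ m → m ≤ n →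
      ∑ i ∈ Finset.Icc 2 m, Real.logb 2 ((|(p i : ℤ) - (p (i - 1) : ℤ)| : ℝ) + 1) +
        Real.logb 2 ((|(p m : ℤ) - (phat m : ℤ)| : ℝ) + 1) ≤
      ((phat m : ℝ) - phat 1) +
        2 * ∑ i ∈ Finset.Icc 1 m, Real.logb 2 ((|(p i : ℤ) - (phat i : ℤ)| : ℝ) + 1) := by
    intro m hm
    induction m, hm using Nat.le_induction with
    | base =>
      intro _
      have h : 0 ≤ Real.logb 2 ((|(p 1 : ℤ) - (phat 1 : ℤ)| : ℝ) + 1) :=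
        Real.logb_nonneg (by norm_num) (le_add_of_nonneg_left (abs_nonneg _))
      simp only [Finset.Icc_self, Finset.sum_singleton]
      rw [Finset.Icc_eq_empty (by norm_num), Finset.sum_empty]
      linarith
    | succ m hm ih =>
      intro hmn
      have ih := ih (by omega)
      rw [Finset.sum_Icc_succ_top (by omega), Finset.sum_Icc_succ_top (by omega)]
      have h := step_log (p m) (p (m + 1)) (phat m) (phat (m + 1))
        (hmono m (m + 1) hm (by omega) hmn)
      simp only [Nat.add_sub_cancel, Int.cast_natCast] at ih ⊢
      linarith
  have hk := key n (by omega) le_rfl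
  have h0 : 0 ≤ Real.logb 2 ((|(p n : ℤ) - (phat n : ℤ)| : ℝ) + 1) :=
    Real.logb_nonneg (by norm_num) (le_add_of_nonneg_left (abs_nonneg _))
  have h3 : 0 ≤ Real.logb 2 3 := Real.logb_nonneg (by norm_num) (by norm_num)
  have hn1 : (0 : ℝ) ≤ (n : ℝ) - 1 := by
    have : (2 : ℝ) ≤ n := by exact_mod_cast hn
    linarith
  have hle : (phat n : ℝ) ≤ n := by
    exact_mod_cast (Finset.mem_Icc.mp (hphatmem n (Finset.mem_Icc.mpr ⟨by omega, le_rfl⟩))).2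
  have hp1 : (0 : ℝ) ≤ phat 1 := Nat.cast_nonneg _
  have := mul_nonneg hn1 h3
  linarith
end

section
/- Let n ≥ 1 and let p and p̂ be permutations of {1,…,n}. Then Σ_{i=1}^{n} |p̂(i) − p(i)| ≤ 2·|{ {i,j} : i ≠ j and (p̂(i) < p̂(j)) ≠ (p(i) < p(j)) }|, i.e. the total displacement is at most twice the number of discordant pairs between the two rankings. -/
/-- The rank of an item is the number of items placed before it. -/
theorem perm_rank_eq (n : ℕ) (q : Equiv.Perm (Fin n)) (i : Fin n) :
    ((q i : ℕ) : ℤ) = ∑ j : Fin n, if q j < q i then (1 : ℤ) else 0 := by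
  rw [Equiv.sum_comp q (fun k => if k < q i then (1 : ℤ) else 0)]
  rw [Finset.sum_boole]
  have h : (Finset.univ.filter (fun k => k < q i)) = Finset.Iio (q i) := by
    ext k; simp
  rw [h, Fin.card_Iio]

/-- Total displacement between two rankings is at most twice the number of discordant
pairs: `Σ_i |p̂(i) − p(i)| ≤ 2·|{ {i,j} : i ≠ j, (p̂(i) < p̂(j)) ≠ (p(i) < p(j)) }|`,
where unordered pairs are counted via ordered pairs with `i < j`. -/
theorem displacement_le_two_discordant (n : ℕ) (hn : 1 ≤ n)
    (p phat : Equiv.Perm (Fin n)) :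
    ∑ i : Fin n, |(phat i : ℤ) - (p i : ℤ)| ≤
      2 * (Finset.univ.filter (fun x : Fin n × Fin n =>
        x.1 < x.2 ∧ ((phat x.1 < phat x.2) ≠ (p x.1 < p x.2)))).card := by
  classical
  let e : Fin n → Fin n → ℤ := fun i j =>
    if i < j ∧ ((phat i < phat j) ≠ (p i < p j)) then 1 else 0
  have hcard : (((Finset.univ.filter (fun x : Fin n × Fin n =>
        x.1 < x.2 ∧ ((phat x.1 < phat x.2) ≠ (p x.1 < p x.2)))).card : ℕ) : ℤ)
      = ∑ i, ∑ j, e i j := by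
    rw [← Fintype.sum_prod_type' e, ← Finset.sum_boole]
  have hi : ∀ i, |(phat i : ℤ) - (p i : ℤ)| ≤ ∑ j, (e i j + e j i) := by
    intro i
    rw [perm_rank_eq n phat i, perm_rank_eq n p i, ← Finset.sum_sub_distrib]
    refine (Finset.abs_sum_le_sum_abs _ _).trans (Finset.sum_le_sum fun j _ => ?_)
    simp only [e, ne_eq, eq_iff_iff]
    rcases lt_trichotomy i j with h | h | h
    · have h1 : phat i ≠ phat j := fun hh => h.ne (phat.injective hh)
      have h2 : p i ≠ p j := fun hh => h.ne (p.injective hh)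
      have h3 : phat i < phat j ↔ ¬ phat j < phat i := by
        rw [not_lt]; exact ⟨le_of_lt, fun k => lt_of_le_of_ne k h1⟩
      have h4 : p i < p j ↔ ¬ p j < p i := by
        rw [not_lt]; exact ⟨le_of_lt, fun k => lt_of_le_of_ne k h2⟩
      simp only [h3, h4]
      by_cases a : phat j < phat i <;> by_cases b : p j < p i <;> simp [a, b, h, h.not_gt]
    · subst h; simp
    · by_cases a : phat j < phat i <;> by_cases b : p j < p i <;> simp [a, b, h, h.not_gt]
  rw [hcard]
  refine (Finset.sum_le_sum fun i _ => hi i).trans (le_of_eq ?_)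
  simp only [Finset.sum_add_distrib]
  rw [Finset.sum_comm (f := fun i j => e j i)]
  ring
end

section
/- Let n ≥ 2 and let s be an integer with 1 ≤ s ≤ n−1. Let p be the identity permutation of {1,…,n} and define p̂(i) = ((i − 1 + s) mod n) + 1. Then for every i ∈ {1,…,n} we have min{η^l_i, η^r_i} = 0, where η^l_i = |{j : p̂(j) ≤ p̂(i) and p(j) > p(i)}| and η^r_i = |{j : p̂(j) ≥ p̂(i) and p(j) < p(i)}|; moreover Σ_{i=1}^{n} log₂(|p̂(i) − p(i)| + 2) ≥ (n − s)·log₂(s + 2). -/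
/-- For the cyclic-shift prediction `p̂(i) = ((i−1+s) mod n) + 1` against the identity
permutation `p`, every item has `min{η^l_i, η^r_i} = 0`, yet the total displacement
measure satisfies `Σ_i log₂(|p̂(i) − p(i)| + 2) ≥ (n − s)·log₂(s + 2)`. -/
theorem cyclic_shift_instance (n s : ℕ) (hn : 2 ≤ n) (hs1 : 1 ≤ s) (hs2 : s ≤ n - 1)
    (p phat : ℕ → ℕ) (hp : ∀ i, p i = i)
    (hphat : ∀ i, phat i = (i - 1 + s) % n + 1) :
    (∀ i ∈ Finset.Icc 1 n,
      min ((Finset.Icc 1 n).filter (fun j => phat j ≤ phat i ∧ p i < p j)).card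
          ((Finset.Icc 1 n).filter (fun j => phat i ≤ phat j ∧ p j < p i)).card = 0) ∧
    ((n : ℝ) - (s : ℝ)) * Real.logb 2 ((s : ℝ) + 2) ≤
      ∑ i ∈ Finset.Icc 1 n, Real.logb 2 ((|(phat i : ℤ) - (p i : ℤ)| : ℝ) + 2) := by
  have h1 : ∀ i, 1 ≤ i → i ≤ n - s → phat i = i + s := by
    intro i h h'
    rw [hphat, Nat.mod_eq_of_lt (by omega)]
    omega
  have h2 : ∀ i, n - s < i → i ≤ n → phat i + n = i + s := by
    intro i h h'
    rw [hphat, Nat.mod_eq_sub_mod (by omega), Nat.mod_eq_of_lt (by omega)]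
    omega
  constructor
  · intro i hi
    rw [Finset.mem_Icc] at hi
    rw [Nat.min_eq_zero_iff, Finset.card_eq_zero, Finset.card_eq_zero,
      Finset.filter_eq_empty_iff, Finset.filter_eq_empty_iff]
    by_cases h : i ≤ n - s
    · right
      intro j hj
      rw [Finset.mem_Icc] at hj
      rw [hp, hp]
      rintro ⟨ha, hb⟩
      have := h1 i hi.1 h
      have := h1 j hj.1 (by omega)
      omega
    · left
      intro j hj
      rw [Finset.mem_Icc] at hj
      rw [hp, hp]
      rintro ⟨ha, hb⟩
      have := h2 i (by omega) hi.2
      have := h2 j (by omega) hj.2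
      omega
  · have hsub : Finset.Icc 1 (n - s) ⊆ Finset.Icc 1 n :=
      Finset.Icc_subset_Icc_right (by omega)
    refine le_trans (le_of_eq ?_) (Finset.sum_le_sum_of_subset_of_nonneg hsub ?_)
    · rw [Finset.sum_congr rfl (g := fun _ => Real.logb 2 ((s : ℝ) + 2))]
      · rw [Finset.sum_const, Nat.card_Icc, nsmul_eq_mul, Nat.add_sub_cancel,
          Nat.cast_sub (by omega)]
      · intro i hi
        rw [Finset.mem_Icc] at hi
        rw [h1 i hi.1 hi.2, hp]
        push_cast
        rw [add_sub_cancel_left, abs_of_nonneg (Nat.cast_nonneg s)]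
    · intro i _ _
      apply Real.logb_nonneg (by norm_num)
      have := abs_nonneg (((phat i : ℤ) : ℝ) - ((p i : ℤ) : ℝ))
      linarith
end

section
/- Let n and m be positive integers with 2m ≤ n. Let p be the identity permutation of {1,…,n} and define p̂(i) = i + (n−m) for i ≤ m, p̂(i) = i − (n−m) for i > n−m, and p̂(i) = i otherwise. Then Σ_{i=1}^{n} log₂(|p̂(i) − p(i)| + 2) ≤ n + 2m·log₂(n + 2), and for every i with m < i ≤ n−m both η^l_i ≥ m and η^r_i ≥ m, where η^l_i = |{j : p̂(j) ≤ p̂(i) and p(j) > p(i)}| and η^r_i = |{j : p̂(j) ≥ p̂(i) and p(j) < p(i)}|; consequently Σ_{i=1}^{n} log₂(min{η^l_i, η^r_i} + 2) ≥ (n − 2m)·log₂(m + 2). -/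
/-- For the prediction swapping the `m` smallest and `m` largest positions against the
identity permutation `p`: the displacement measure is at most `n + 2m·log₂(n+2)`, every
middle item `m < i ≤ n−m` has `η^l_i ≥ m` and `η^r_i ≥ m`, and consequently
`Σ_i log₂(min{η^l_i, η^r_i} + 2) ≥ (n − 2m)·log₂(m + 2)`. -/
theorem swap_extremes_instance (n m : ℕ) (hm : 1 ≤ m) (hmn : 2 * m ≤ n)
    (p phat : ℕ → ℕ) (hp : ∀ i, p i = i)
    (hphat : ∀ i, phat i =
      if i ≤ m then i + (n - m) else if n - m < i then i - (n - m) else i) :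
    (∑ i ∈ Finset.Icc 1 n, Real.logb 2 ((|(phat i : ℤ) - (p i : ℤ)| : ℝ) + 2) ≤
        (n : ℝ) + 2 * (m : ℝ) * Real.logb 2 ((n : ℝ) + 2)) ∧
    (∀ i, m < i → i ≤ n - m →
      m ≤ ((Finset.Icc 1 n).filter (fun j => phat j ≤ phat i ∧ p i < p j)).card ∧
      m ≤ ((Finset.Icc 1 n).filter (fun j => phat i ≤ phat j ∧ p j < p i)).card) ∧
    ((n : ℝ) - 2 * (m : ℝ)) * Real.logb 2 ((m : ℝ) + 2) ≤
      ∑ i ∈ Finset.Icc 1 n, Real.logb 2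
        ((min ((Finset.Icc 1 n).filter (fun j => phat j ≤ phat i ∧ p i < p j)).card
              ((Finset.Icc 1 n).filter (fun j => phat i ≤ phat j ∧ p j < p i)).card : ℕ) + 2) := by
  have h2 : ∀ i, m < i → i ≤ n - m →
      m ≤ ((Finset.Icc 1 n).filter (fun j => phat j ≤ phat i ∧ p i < p j)).card ∧
      m ≤ ((Finset.Icc 1 n).filter (fun j => phat i ≤ phat j ∧ p j < p i)).card := by
    intro i hi1 hi2
    have hi : phat i = i := by
      rw [hphat, if_neg (by omega), if_neg (by omega)]
    constructor
    · have hsub : Finset.Icc (n - m + 1) n ⊆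
          (Finset.Icc 1 n).filter (fun j => phat j ≤ phat i ∧ p i < p j) := by
        intro j hj
        rw [Finset.mem_Icc] at hj
        rw [Finset.mem_filter, Finset.mem_Icc, hi, hp, hp, hphat j, if_neg (by omega),
          if_pos (by omega)]
        omega
      have hc := Finset.card_le_card hsub
      rw [Nat.card_Icc] at hc
      omega
    · have hsub : Finset.Icc 1 m ⊆
          (Finset.Icc 1 n).filter (fun j => phat i ≤ phat j ∧ p j < p i) := by
        intro j hj
        rw [Finset.mem_Icc] at hj
        rw [Finset.mem_filter, Finset.mem_Icc, hi, hp, hp, hphat j, if_pos (by omega)]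
        omega
      have hc := Finset.card_le_card hsub
      rw [Nat.card_Icc] at hc
      omega
  refine ⟨?_, h2, ?_⟩
  · have hL : 0 ≤ Real.logb 2 ((n : ℝ) + 2) :=
      Real.logb_nonneg (by norm_num) (by have : (0 : ℝ) ≤ n := n.cast_nonneg; linarith)
    have hterm : ∀ i ∈ Finset.Icc 1 n,
        Real.logb 2 ((|(phat i : ℤ) - (p i : ℤ)| : ℝ) + 2) ≤
          1 + if i ∈ Finset.Icc 1 m ∪ Finset.Icc (n - m + 1) n then
            Real.logb 2 ((n : ℝ) + 2) else 0 := by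
      intro i hi
      rw [Finset.mem_Icc] at hi
      split_ifs with h
      · have habs : (|(phat i : ℤ) - (p i : ℤ)| : ℝ) ≤ n := by
          have : |(phat i : ℤ) - (p i : ℤ)| ≤ (n : ℤ) := by
            rw [abs_le, hp, hphat]
            split_ifs <;> omega
          exact_mod_cast this
        have : Real.logb 2 ((|(phat i : ℤ) - (p i : ℤ)| : ℝ) + 2) ≤
            Real.logb 2 ((n : ℝ) + 2) :=
          Real.logb_le_logb_of_le (by norm_num) (by positivity) (by linarith)
        linarith
      · rw [Finset.mem_union, Finset.mem_Icc, Finset.mem_Icc] at h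
        have hi' : phat i = i := by
          rw [hphat, if_neg (by omega), if_neg (by omega)]
        rw [hi', hp]
        simp
    refine (Finset.sum_le_sum hterm).trans ?_
    rw [Finset.sum_add_distrib, ← Finset.sum_filter]
    simp only [Finset.sum_const, Nat.card_Icc, nsmul_eq_mul, mul_one, Nat.add_sub_cancel]
    have hc : ((Finset.Icc 1 n).filter
        (fun i => i ∈ Finset.Icc 1 m ∪ Finset.Icc (n - m + 1) n)).card ≤ 2 * m := by
      have h1 := Finset.card_le_card (show (Finset.Icc 1 n).filter
        (fun i => i ∈ Finset.Icc 1 m ∪ Finset.Icc (n - m + 1) n) ⊆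
          Finset.Icc 1 m ∪ Finset.Icc (n - m + 1) n from
            fun i hi => (Finset.mem_filter.mp hi).2)
      have h3 := Finset.card_union_le (Finset.Icc 1 m) (Finset.Icc (n - m + 1) n)
      rw [Nat.card_Icc, Nat.card_Icc] at h3
      omega
    have hc' : (((Finset.Icc 1 n).filter
        (fun i => i ∈ Finset.Icc 1 m ∪ Finset.Icc (n - m + 1) n)).card : ℝ) ≤ 2 * m := by
      exact_mod_cast hc
    have := mul_le_mul_of_nonneg_right hc' hL
    linarith
  · have hsub : Finset.Icc (m + 1) (n - m) ⊆ Finset.Icc 1 n := by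
      intro i hi
      rw [Finset.mem_Icc] at hi ⊢
      omega
    refine le_trans ?_ (Finset.sum_le_sum_of_subset_of_nonneg hsub ?_)
    · have hcard : ((n : ℝ) - 2 * (m : ℝ)) = ((Finset.Icc (m + 1) (n - m)).card : ℝ) := by
        rw [Nat.card_Icc, show n - m + 1 - (m + 1) = n - 2 * m by omega, Nat.cast_sub hmn]
        push_cast
        ring
      rw [hcard, ← nsmul_eq_mul]
      refine Finset.card_nsmul_le_sum _ _ _ ?_
      intro i hi
      rw [Finset.mem_Icc] at hi
      obtain ⟨ha, hb⟩ := h2 i (by omega) hi.2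
      have hmin := le_min ha hb
      refine Real.logb_le_logb_of_le (by norm_num) (by positivity) ?_
      gcongr
    · intro i _ _
      refine Real.logb_nonneg (by norm_num) ?_
      have : ∀ k : ℕ, (1 : ℝ) ≤ (k : ℝ) + 2 := fun k => by
        have : (0 : ℝ) ≤ k := k.cast_nonneg
        linarith
      exact this _
end
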